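/- Let 𝒜, ℬ be rightward open MDPs with arities (m,0)→(l,0) and (l,0)→(n,0), i an entrance of 𝒜, and (L^𝒜,U^𝒜), (L^ℬ,U^ℬ) sound approximations. Let σ^𝒜, σ^ℬ be memoryless schedulers on D(U^𝒜), D(U^ℬ) and τ^𝒜, τ^ℬ memoryless schedulers on D(L^𝒜), D(L^ℬ). Set ε^𝒜 := sup_{k∈O^𝒜} |Pr^{D(U^𝒜),σ^𝒜}(i ⊨ ◇k) − Pr^{D(L^𝒜),τ^𝒜}(i ⊨ ◇k)| and ε^ℬ := sup_{k∈I^ℬ} sup_{j∈O^ℬ} |Pr^{D(U^ℬ),σ^ℬ}(k ⊨ ◇j) − Pr^{D(L^ℬ),τ^ℬ}(k ⊨ ◇j)|. Then sup_{j∈O^ℬ} |Pr^{D(U^𝒜)⨟D(U^ℬ), σ^𝒜⨟σ^ℬ}(i ⊨ ◇j) − Pr^{D(L^𝒜)⨟D(L^ℬ), τ^𝒜⨟τ^ℬ}(i ⊨ ◇j)| ≤ |O^𝒜| · ε^𝒜 + ε^ℬ. -/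

import Mathlib

open scoped Classical ENNReal

namespace SD

/-- A Markov decision process with finite sets of states and actions: a partial
transition function assigning to a state and an action a probability
distribution over states. -/
structure MDP (S A : Type) : Type where
  P : S → A → Option (S → ℝ)

namespace MDP

variable {S A : Type} [Fintype S] [Fintype A]

/-- All defined transitions are genuine probability distributions. -/
def Proper (M : MDP S A) : Prop :=
  ∀ s a d, M.P s a = some d → (∀ s', 0 ≤ d s') ∧ ∑ s', d s' = 1

/-- The action `a` is enabled in `s`. -/
def enabled (M : MDP S A) (s : S) (a : A) : Prop := M.P s a ≠ none

/-- A state is terminal if no action is enabled in it. -/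
def terminal (M : MDP S A) (s : S) : Prop := ∀ a, M.P s a = none

/-- Transition probabilities. -/
noncomputable def prob (M : MDP S A) (s : S) (a : A) (s' : S) : ℝ :=
  (M.P s a).elim 0 fun d => d s'

end MDP

/-- A finite path of an MDP: a start state with a list of (action, next state) steps. -/
structure FinPath (S A : Type) : Type where
  start : S
  steps : List (A × S)

namespace FinPath

/-- The last state of a finite path. -/
def last {S A : Type} (π : FinPath S A) : S := (π.steps.map Prod.snd).getLastD π.start

/-- Extending a finite path by one step. -/
def snoc {S A : Type} (π : FinPath S A) (a : A) (s : S) : FinPath S A :=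
  ⟨π.start, π.steps ++ [(a, s)]⟩

end FinPath

namespace MDP

variable {S A : Type} [Fintype S] [Fintype A]

/-- Consistency of a sequence of steps with the transitions, from a given state. -/
def ConsistentFrom (M : MDP S A) : S → List (A × S) → Prop
  | _, [] => True
  | s, (a, s') :: l => M.prob s a s' ≠ 0 ∧ ConsistentFrom M s' l

/-- A finite path is consistent if every step has nonzero probability. -/
def Consistent (M : MDP S A) (π : FinPath S A) : Prop := M.ConsistentFrom π.start π.steps

end MDP

/-- A (history-dependent, stochastic) scheduler, given by its raw weights. -/
abbrev Sched (S A : Type) : Type := FinPath S A → A → ℝ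

namespace MDP

variable {S A : Type} [Fintype S] [Fintype A]

/-- `σ` is a scheduler for `M`: it assigns to every (consistent) finite path a
probability distribution over the actions enabled in its last state. -/
def IsSched (M : MDP S A) (σ : Sched S A) : Prop :=
  ∀ π : FinPath S A, M.Consistent π →
    (∀ a, 0 ≤ σ π a) ∧ (∀ a, σ π a ≠ 0 → M.enabled π.last a) ∧
      (¬M.terminal π.last → ∑ a, σ π a = 1)

end MDP

/-- Memoryless schedulers depend only on the last state of a path. -/
def Memoryless {S A : Type} (σ : Sched S A) : Prop :=
  ∀ π π' : FinPath S A, π.last = π'.last → σ π = σ π'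

/-- Deterministic schedulers choose Dirac distributions. -/
def Deterministic {S A : Type} (σ : Sched S A) : Prop := ∀ π a, σ π a = 0 ∨ σ π a = 1

/-- Deterministic memoryless (DM) schedulers. -/
def DM {S A : Type} (σ : Sched S A) : Prop := Memoryless σ ∧ Deterministic σ

namespace MDP

variable {S A : Type} [Fintype S] [Fintype A]

/-- Probability of visiting `T` within `n` steps (terminal states made absorbing),
starting from the history `π`, under the scheduler `σ`. -/
noncomputable def reachN (M : MDP S A) (σ : Sched S A) (T : Set S) :
    ℕ → FinPath S A → ℝ
  | 0, π => if π.last ∈ T then 1 else 0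
  | n + 1, π =>
      if π.last ∈ T then 1
      else ∑ a : A, σ π a * ∑ s' : S, M.prob π.last a s' * reachN M σ T n (π.snoc a s')

/-- `Pr^{M,σ}(s ⊨ ◇T)`: the probability, under the measure on infinite paths induced
by `σ` from `s` (terminal states made absorbing), of the paths that visit `T`; it is
the supremum of the bounded-horizon reachability probabilities. -/
noncomputable def Pr (M : MDP S A) (σ : Sched S A) (s : S) (T : Set S) : ℝ :=
  ⨆ n : ℕ, M.reachN σ T n ⟨s, []⟩

end MDP

/-- An open MDP: an MDP together with (totally ordered, given as lists) sets of
rightward/leftward entrances and exits. -/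
structure OMDP (S A : Type) : Type where
  M : MDP S A
  Ir : List S
  Il : List S
  Or : List S
  Ol : List S

namespace OMDP

variable {S A : Type}

/-- The entrances `I = I_r ∪ I_l`. -/
def entr (𝒜 : OMDP S A) : List S := 𝒜.Ir ++ 𝒜.Il

/-- The exits `O = O_r ∪ O_l`. -/
def exit (𝒜 : OMDP S A) : List S := 𝒜.Or ++ 𝒜.Ol

/-- The index type of exits. -/
abbrev ExitIdx (𝒜 : OMDP S A) : Type := {s : S // s ∈ 𝒜.exit}

/-- The index type of entrances. -/
abbrev EntrIdx (𝒜 : OMDP S A) : Type := {s : S // s ∈ 𝒜.entr}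

variable [Fintype S] [Fintype A]

/-- Well-formedness of an open MDP: the transitions are probability
distributions, the open ends are pairwise disjoint (each without duplicates),
and the exits are exactly the terminal states. -/
def WF (𝒜 : OMDP S A) : Prop :=
  𝒜.M.Proper ∧ (𝒜.Ir ++ 𝒜.Il ++ 𝒜.Or ++ 𝒜.Ol).Nodup ∧
    ∀ s : S, s ∈ 𝒜.exit ↔ 𝒜.M.terminal s

/-- `Pr^{𝒜,σ}(i ⊨ ◇O) ∈ ℝ^O`: the vector of reachability probabilities to each exit. -/
noncomputable def prVec (𝒜 : OMDP S A) (σ : Sched S A) (i : S) : 𝒜.ExitIdx → ℝ :=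
  fun j => 𝒜.M.Pr σ i {j.1}

/-- The set `A^𝒜(i)` of achievable points from `i`. -/
def achievable (𝒜 : OMDP S A) (i : S) : Set (𝒜.ExitIdx → ℝ) :=
  {p | ∃ σ : Sched S A, 𝒜.M.IsSched σ ∧ p ≤ 𝒜.prVec σ i}

/-- The set `A^{𝒜,Σ}(i)` of points achievable from `i` by schedulers in the class `C`. -/
def achievableBy (𝒜 : OMDP S A) (i : S) (C : Sched S A → Prop) : Set (𝒜.ExitIdx → ℝ) :=
  {p | ∃ σ : Sched S A, 𝒜.M.IsSched σ ∧ C σ ∧ p ≤ 𝒜.prVec σ i}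

/-- The Pareto curve `𝒮(𝒜, i)`: achievable points not strictly dominated by an
achievable point. -/
def pareto (𝒜 : OMDP S A) (i : S) : Set (𝒜.ExitIdx → ℝ) :=
  {p | p ∈ 𝒜.achievable i ∧ ∀ q ∈ 𝒜.achievable i, p ≤ q → q = p}

end OMDP

/-- Downward closure. -/
def dw {ι : Type} (X : Set (ι → ℝ)) : Set (ι → ℝ) := {p | ∃ q ∈ X, p ≤ q}

/-- Downward convex closure. -/
def dwConv {ι : Type} (X : Set (ι → ℝ)) : Set (ι → ℝ) := dw (convexHull ℝ X)

/-- Subdistributions on `ι`: nonnegative points with coordinate sum at most 1. -/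
def Subdist {ι : Type} [Fintype ι] (p : ι → ℝ) : Prop :=
  (∀ j, 0 ≤ p j) ∧ ∑ j, p j ≤ 1

end SD

namespace SD

namespace OMDP

variable {S A : Type} [Fintype S] [Fintype A]

/-- The actions of a shortcut oMDP for the family `B`: the union of the `B i`. -/
abbrev ShortAct (𝒜 : OMDP S A) (B : 𝒜.EntrIdx → Finset (𝒜.ExitIdx → ℝ)) : Type :=
  {p : 𝒜.ExitIdx → ℝ // ∃ i, p ∈ B i}

noncomputable instance instFintypeShortAct (𝒜 : OMDP S A)
    (B : 𝒜.EntrIdx → Finset (𝒜.ExitIdx → ℝ)) : Fintype (ShortAct 𝒜 B) := by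
  have h : {p : 𝒜.ExitIdx → ℝ | ∃ i, p ∈ B i}.Finite := by
    have he : {p : 𝒜.ExitIdx → ℝ | ∃ i, p ∈ B i} =
        ⋃ i, ((B i : Finset (𝒜.ExitIdx → ℝ)) : Set (𝒜.ExitIdx → ℝ)) := by
      ext p; simp
    rw [he]
    exact Set.finite_iUnion fun i => (B i).finite_toSet
  exact h.fintype

/-- The shortcut oMDP `D(B)` of a family `B = (B_i)_{i ∈ I}` of finite sets of
subdistributions on the exits: states are the entrances and exits of `𝒜`
together with a fresh sink `⋆` (encoded by `Option S`, with `⋆ = none`), actions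
are the points in the `B_i`, and from entrance `i` the action `p ∈ B_i` moves to
exit `o` with probability `p(o)` and to `⋆` with the remaining probability
`1 - Σ_o p(o)`. -/
noncomputable def shortcut (𝒜 : OMDP S A) (B : 𝒜.EntrIdx → Finset (𝒜.ExitIdx → ℝ)) :
    OMDP (Option S) (ShortAct 𝒜 B) where
  M := ⟨fun t a =>
    match t with
    | none => none
    | some s =>
        if _h : ∃ hs : s ∈ 𝒜.entr, a.1 ∈ B ⟨s, hs⟩ then
          some fun t' =>
            match t' with
            | none => 1 - ∑ j : 𝒜.ExitIdx, a.1 j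
            | some s' => ∑ j : 𝒜.ExitIdx, if j.1 = s' then a.1 j else 0
        else none⟩
  Ir := 𝒜.Ir.map some
  Il := 𝒜.Il.map some
  Or := 𝒜.Or.map some
  Ol := 𝒜.Ol.map some

end OMDP

/-- Transporting points in `ℝ^{O_𝒴}` to points in `ℝ^{O_𝒳}` along a map of exits. -/
def pullExit {S₁ A₁ S₂ A₂ : Type} (𝒳 : OMDP S₁ A₁) (𝒴 : OMDP S₂ A₂) (f : S₁ → S₂)
    (hf : ∀ s ∈ 𝒳.exit, f s ∈ 𝒴.exit) (p : 𝒴.ExitIdx → ℝ) : 𝒳.ExitIdx → ℝ :=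
  fun j => p ⟨f j.1, hf j.1 j.2⟩

end SD

namespace SD

namespace OMDP

variable {S₁ A₁ S₂ A₂ : Type}

/-- The sequential composition `𝒜 ⨟ ℬ` of type-matching open MDPs: the disjoint
union of the two oMDPs in which the `i`-th rightward exit of `𝒜` moves with
probability 1 to the `i`-th rightward entrance of `ℬ` and the `i`-th leftward
exit of `ℬ` moves with probability 1 to the `i`-th leftward entrance of `𝒜`;
its entrances are `(I_r^𝒜, I_l^ℬ)` and its exits are `(O_r^ℬ, O_l^𝒜)`. -/
noncomputable def seqComp (𝒜 : OMDP S₁ A₁) (ℬ : OMDP S₂ A₂)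
    (h₁ : 𝒜.Or.length = ℬ.Ir.length) (h₂ : ℬ.Ol.length = 𝒜.Il.length) :
    OMDP (S₁ ⊕ S₂) (A₁ ⊕ A₂) where
  M := ⟨fun t a =>
    match t with
    | Sum.inl s =>
        if h : ∃ k : Fin 𝒜.Or.length, 𝒜.Or.get k = s then
          some fun t' => if t' = Sum.inr (ℬ.Ir.get (Fin.cast h₁ h.choose)) then 1 else 0
        else
          match a with
          | Sum.inl a => (𝒜.M.P s a).map fun d => Sum.elim d fun _ => 0
          | Sum.inr _ => none
    | Sum.inr s =>
        if h : ∃ k : Fin ℬ.Ol.length, ℬ.Ol.get k = s then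
          some fun t' => if t' = Sum.inl (𝒜.Il.get (Fin.cast h₂ h.choose)) then 1 else 0
        else
          match a with
          | Sum.inr a => (ℬ.M.P s a).map fun d => Sum.elim (fun _ => 0) d
          | Sum.inl _ => none⟩
  Ir := 𝒜.Ir.map Sum.inl
  Il := ℬ.Il.map Sum.inr
  Or := ℬ.Or.map Sum.inr
  Ol := 𝒜.Ol.map Sum.inl

/-- The sequential composition `σ₁ ⨟ σ₂` of memoryless schedulers on `𝒜` and `ℬ`:
it behaves like `σ₁` on the states of `𝒜` and like `σ₂` on the states of `ℬ`
(on the connecting exits, where all actions induce the same probability-1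
transition, it plays uniformly). -/
noncomputable def schedSeqComp [Fintype A₁] [Fintype A₂] (𝒜 : OMDP S₁ A₁) (ℬ : OMDP S₂ A₂)
    (σ₁ : Sched S₁ A₁) (σ₂ : Sched S₂ A₂) : Sched (S₁ ⊕ S₂) (A₁ ⊕ A₂) := fun π a =>
  match π.last, a with
  | Sum.inl s, a =>
      if s ∈ 𝒜.Or then ((Fintype.card (A₁ ⊕ A₂) : ℝ))⁻¹
      else
        match a with
        | Sum.inl a => σ₁ ⟨s, []⟩ a
        | Sum.inr _ => 0
  | Sum.inr s, a =>
      if s ∈ ℬ.Ol then ((Fintype.card (A₁ ⊕ A₂) : ℝ))⁻¹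
      else
        match a with
        | Sum.inr a => σ₂ ⟨s, []⟩ a
        | Sum.inl _ => 0

/-- The restriction of a (memoryless) scheduler on `𝒜 ⨟ ℬ` to the states of `𝒜`. -/
noncomputable def restrictL [Fintype S₁] [Fintype A₁] (𝒜 : OMDP S₁ A₁)
    (τ : Sched (S₁ ⊕ S₂) (A₁ ⊕ A₂)) : Sched S₁ A₁ := fun π a =>
  if 𝒜.M.terminal π.last then 0 else τ ⟨Sum.inl π.last, []⟩ (Sum.inl a)

/-- The restriction of a (memoryless) scheduler on `𝒜 ⨟ ℬ` to the states of `ℬ`. -/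
noncomputable def restrictR [Fintype S₂] [Fintype A₂] (ℬ : OMDP S₂ A₂)
    (τ : Sched (S₁ ⊕ S₂) (A₁ ⊕ A₂)) : Sched S₂ A₂ := fun π a =>
  if ℬ.M.terminal π.last then 0 else τ ⟨Sum.inr π.last, []⟩ (Sum.inr a)

end OMDP

end SD

namespace SD

@[simp] lemma FinPath.last_snoc {S A : Type} (π : FinPath S A) (a : A) (s : S) :
    (π.snoc a s).last = s := by
  simp [FinPath.last, FinPath.snoc, List.getLastD_eq_getLast?]

@[simp] lemma FinPath.last_nil {S A : Type} (s : S) :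
    (⟨s, []⟩ : FinPath S A).last = s := rfl

namespace MDP

variable {S A : Type} [Fintype S] [Fintype A]

lemma reachN_of_mem (M : MDP S A) (σ : Sched S A) {T : Set S} {π : FinPath S A}
    (h : π.last ∈ T) (n : ℕ) : M.reachN σ T n π = 1 := by
  cases n <;> simp [reachN, h]

lemma reachN_succ_of_notMem (M : MDP S A) (σ : Sched S A) {T : Set S} {π : FinPath S A}
    (h : π.last ∉ T) (n : ℕ) : M.reachN σ T (n + 1) π =
      ∑ a, σ π a * ∑ s', M.prob π.last a s' * M.reachN σ T n (π.snoc a s') := by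
  simp [reachN, h]

lemma reachN_eq_zero (M : MDP S A) (σ : Sched S A) {T : Set S} {π : FinPath S A}
    (h : π.last ∉ T) (hp : ∀ a s', σ π a * M.prob π.last a s' = 0) (n : ℕ) :
    M.reachN σ T n π = 0 := by
  cases n with
  | zero => simp [reachN, h]
  | succ n =>
    rw [reachN_succ_of_notMem M σ h]
    refine Finset.sum_eq_zero fun a _ => ?_
    rw [Finset.mul_sum]
    exact Finset.sum_eq_zero fun s' _ => by rw [← mul_assoc, hp, zero_mul]

/-- A bounded-horizon reachability probability that jumps from `0` to `c` at horizon `N`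
has limit `c`. -/
lemma Pr_eq_of_reachN (M : MDP S A) (σ : Sched S A) (s : S) (T : Set S) {c : ℝ} (hc : 0 ≤ c)
    (N : ℕ) (h : ∀ n, M.reachN σ T n ⟨s, []⟩ = if n < N then 0 else c) :
    M.Pr σ s T = c := by
  have hle : ∀ n, M.reachN σ T n ⟨s, []⟩ ≤ c := fun n => by
    rw [h]; split_ifs <;> simp [hc]
  refine le_antisymm (ciSup_le hle) ?_
  have := le_ciSup (f := fun n => M.reachN σ T n ⟨s, []⟩) ⟨c, by rintro _ ⟨n, rfl⟩; exact hle n⟩ N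
  simpa [h, Pr] using this

/-- No two consecutive transitions have nonzero probability. -/
def OneStep (M : MDP S A) : Prop :=
  ∀ s a s' a' s'', M.prob s a s' ≠ 0 → M.prob s' a' s'' = 0

/-- One-step transition probabilities under a memoryless scheduler. -/
noncomputable def stepProb (M : MDP S A) (σ : Sched S A) (s s' : S) : ℝ :=
  ∑ a, σ ⟨s, []⟩ a * M.prob s a s'

omit [Fintype A] in
lemma Proper.prob_nonneg {M : MDP S A} (h : M.Proper) (s : S) (a : A) (s' : S) :
    0 ≤ M.prob s a s' := by
  unfold prob
  cases hd : M.P s a with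
  | none => simp
  | some d => exact (h s a d hd).1 s'

omit [Fintype A] in
lemma Proper.sum_prob_le_one {M : MDP S A} (h : M.Proper) (s : S) (a : A) :
    ∑ s', M.prob s a s' ≤ 1 := by
  unfold prob
  cases hd : M.P s a with
  | none => simp
  | some d => exact (h s a d hd).2.le

omit [Fintype S] in
lemma IsSched.sum_le_one {M : MDP S A} {σ : Sched S A} (h : M.IsSched σ) (s : S) :
    ∑ a, σ ⟨s, []⟩ a ≤ 1 := by
  obtain ⟨-, h2, h3⟩ := h ⟨s, []⟩ trivial
  by_cases ht : M.terminal s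
  · refine le_of_eq_of_le (Finset.sum_eq_zero fun a _ => ?_) zero_le_one
    by_contra hne
    exact h2 a hne (ht a)
  · exact (h3 ht).le

lemma stepProb_nonneg {M : MDP S A} {σ : Sched S A} (hM : M.Proper) (h : M.IsSched σ)
    (s s' : S) : 0 ≤ M.stepProb σ s s' :=
  Finset.sum_nonneg fun a _ => mul_nonneg ((h ⟨s, []⟩ trivial).1 a) (hM.prob_nonneg s a s')

lemma sum_stepProb_le_one {M : MDP S A} {σ : Sched S A} (hM : M.Proper) (h : M.IsSched σ)
    (s : S) : ∑ s', M.stepProb σ s s' ≤ 1 := by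
  unfold stepProb
  rw [Finset.sum_comm]
  refine le_trans (Finset.sum_le_sum fun a _ => ?_) (h.sum_le_one s)
  rw [← Finset.mul_sum]
  exact mul_le_of_le_one_right ((h ⟨s, []⟩ trivial).1 a) (hM.sum_prob_le_one s a)

lemma stepProb_le_one {M : MDP S A} {σ : Sched S A} (hM : M.Proper) (h : M.IsSched σ)
    (s s' : S) : M.stepProb σ s s' ≤ 1 :=
  (Finset.single_le_sum (f := M.stepProb σ s) (fun t _ => stepProb_nonneg hM h s t)
    (Finset.mem_univ s')).trans (sum_stepProb_le_one hM h s)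

lemma OneStep.Pr_eq_stepProb {M : MDP S A} (h1 : M.OneStep) (hM : M.Proper) {σ : Sched S A}
    (h : M.IsSched σ) {s t : S} (hst : s ≠ t) : M.Pr σ s {t} = M.stepProb σ s t := by
  refine M.Pr_eq_of_reachN σ s {t} (stepProb_nonneg hM h s t) 1 fun n => ?_
  cases n with
  | zero => simp [reachN, hst]
  | succ n =>
    rw [reachN_succ_of_notMem M σ (by simpa using hst)]
    simp only [FinPath.last_nil, Nat.add_lt_iff_lt_sub_right, Nat.sub_self, Nat.not_lt_zero,
      if_false]
    refine Finset.sum_congr rfl fun a _ => congrArg _ ?_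
    rw [Finset.sum_eq_single t]
    · rw [M.reachN_of_mem σ (by simp), mul_one]
    · intro s' _ hs'
      by_cases hp : M.prob s a s' = 0
      · simp [hp]
      · rw [M.reachN_eq_zero σ (by simpa using hs') (fun a' s'' => by simp [h1 _ _ _ a' s'' hp]),
          mul_zero]
    · simp

end MDP

namespace OMDP

section SeqComp

variable {S₁ A₁ S₂ A₂ : Type} (𝒳 : OMDP S₁ A₁) (𝒴 : OMDP S₂ A₂)
  (h₁ : 𝒳.Or.length = 𝒴.Ir.length) (h₂ : 𝒴.Ol.length = 𝒳.Il.length)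

lemma seqComp_prob_inr (hOl : 𝒴.Ol = []) (s : S₂) (a : A₂) (t : S₁ ⊕ S₂) :
    (𝒳.seqComp 𝒴 h₁ h₂).M.prob (Sum.inr s) (Sum.inr a) t =
      Sum.elim (fun _ => 0) (𝒴.M.prob s a) t := by
  have hn : ¬ ∃ k : Fin 𝒴.Ol.length, 𝒴.Ol.get k = s := by
    rintro ⟨k, -⟩
    have := k.2
    simp [hOl] at this
  simp only [MDP.prob, seqComp, dif_neg hn]
  cases h : 𝒴.M.P s a <;> cases t <;> simp [MDP.prob, h]

lemma seqComp_prob_inl {s : S₁} (hs : s ∉ 𝒳.Or) (a : A₁) (t : S₁ ⊕ S₂) :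
    (𝒳.seqComp 𝒴 h₁ h₂).M.prob (Sum.inl s) (Sum.inl a) t =
      Sum.elim (𝒳.M.prob s a) (fun _ => 0) t := by
  have hn : ¬ ∃ k : Fin 𝒳.Or.length, 𝒳.Or.get k = s := by
    rintro ⟨k, rfl⟩
    exact hs (List.get_mem _ _)
  simp only [MDP.prob, seqComp, dif_neg hn]
  cases h : 𝒳.M.P s a <;> cases t <;> simp [MDP.prob, h]

lemma seqComp_prob_exit (hnd : 𝒳.Or.Nodup) (k : Fin 𝒳.Or.length) (a : A₁ ⊕ A₂) (t : S₁ ⊕ S₂) :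
    (𝒳.seqComp 𝒴 h₁ h₂).M.prob (Sum.inl (𝒳.Or.get k)) a t =
      if t = Sum.inr (𝒴.Ir.get (Fin.cast h₁ k)) then 1 else 0 := by
  have he : ∃ k' : Fin 𝒳.Or.length, 𝒳.Or.get k' = 𝒳.Or.get k := ⟨k, rfl⟩
  have hk : he.choose = k := List.nodup_iff_injective_get.1 hnd he.choose_spec
  simp only [MDP.prob, seqComp, dif_pos he, hk, Option.elim]

variable [Fintype A₁] [Fintype A₂] (σ : Sched S₁ A₁) (τ : Sched S₂ A₂)

lemma schedSeqComp_inr (hOl : 𝒴.Ol = []) {π : FinPath (S₁ ⊕ S₂) (A₁ ⊕ A₂)} {s : S₂}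
    (hπ : π.last = Sum.inr s) (a : A₁ ⊕ A₂) :
    schedSeqComp 𝒳 𝒴 σ τ π a = Sum.elim (fun _ => 0) (τ ⟨s, []⟩) a := by
  cases a <;> simp [schedSeqComp, hπ, hOl]

lemma schedSeqComp_inl {π : FinPath (S₁ ⊕ S₂) (A₁ ⊕ A₂)} {s : S₁} (hs : s ∉ 𝒳.Or)
    (hπ : π.last = Sum.inl s) (a : A₁ ⊕ A₂) :
    schedSeqComp 𝒳 𝒴 σ τ π a = Sum.elim (σ ⟨s, []⟩) (fun _ => 0) a := by
  cases a <;> simp [schedSeqComp, hπ, hs]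

lemma schedSeqComp_exit {π : FinPath (S₁ ⊕ S₂) (A₁ ⊕ A₂)} {s : S₁} (hs : s ∈ 𝒳.Or)
    (hπ : π.last = Sum.inl s) (a : A₁ ⊕ A₂) :
    schedSeqComp 𝒳 𝒴 σ τ π a = (Fintype.card (A₁ ⊕ A₂) : ℝ)⁻¹ := by
  simp only [schedSeqComp, hπ, if_pos hs]

variable [Fintype S₁] [Fintype S₂]

lemma reachN_seqComp_inr (hOl : 𝒴.Ol = []) (hY : 𝒴.M.OneStep) {s t : S₂} (hst : s ≠ t)
    {π : FinPath (S₁ ⊕ S₂) (A₁ ⊕ A₂)} (hπ : π.last = Sum.inr s) (n : ℕ) :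
    (𝒳.seqComp 𝒴 h₁ h₂).M.reachN (schedSeqComp 𝒳 𝒴 σ τ) {Sum.inr t} n π =
      if n < 1 then 0 else 𝒴.M.stepProb τ s t := by
  cases n with
  | zero => simp [MDP.reachN, hπ, hst]
  | succ n =>
    rw [MDP.reachN_succ_of_notMem _ _ (by simpa [hπ] using hst)]
    simp only [Nat.add_lt_iff_lt_sub_right, Nat.sub_self, Nat.not_lt_zero, if_false,
      Fintype.sum_sum_type, schedSeqComp_inr 𝒳 𝒴 σ τ hOl hπ, hπ, seqComp_prob_inr 𝒳 𝒴 h₁ h₂ hOl,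
      Sum.elim_inl, Sum.elim_inr, zero_mul, Finset.sum_const_zero, zero_add]
    refine Finset.sum_congr rfl fun a _ => congrArg _ ?_
    rw [Finset.sum_eq_single t]
    · rw [MDP.reachN_of_mem _ _ (by simp), mul_one]
    · intro s' _ hs'
      by_cases hp : 𝒴.M.prob s a s' = 0
      · simp [hp]
      · rw [MDP.reachN_eq_zero _ _ (by simpa using hs'), mul_zero]
        rintro (a' | a') s''
        · simp [schedSeqComp_inr 𝒳 𝒴 σ τ hOl (FinPath.last_snoc _ _ _)]
        · rw [FinPath.last_snoc, seqComp_prob_inr 𝒳 𝒴 h₁ h₂ hOl]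
          cases s'' <;> simp [hY _ _ _ a' _ hp]
    · simp

lemma reachN_seqComp_exit [Nonempty (A₁ ⊕ A₂)] (hOl : 𝒴.Ol = []) (hY : 𝒴.M.OneStep)
    (hnd : 𝒳.Or.Nodup) {t : S₂} (ht : t ∉ 𝒴.Ir) (k : Fin 𝒳.Or.length)
    {π : FinPath (S₁ ⊕ S₂) (A₁ ⊕ A₂)} (hπ : π.last = Sum.inl (𝒳.Or.get k)) (n : ℕ) :
    (𝒳.seqComp 𝒴 h₁ h₂).M.reachN (schedSeqComp 𝒳 𝒴 σ τ) {Sum.inr t} n π =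
      if n < 2 then 0 else 𝒴.M.stepProb τ (𝒴.Ir.get (Fin.cast h₁ k)) t := by
  cases n with
  | zero => simp [MDP.reachN, hπ]
  | succ n =>
    have hne : 𝒴.Ir.get (Fin.cast h₁ k) ≠ t := fun h => ht (h ▸ List.get_mem _ _)
    have hcard : (Fintype.card (A₁ ⊕ A₂) : ℝ) ≠ 0 := Nat.cast_ne_zero.2 Fintype.card_ne_zero
    rw [MDP.reachN_succ_of_notMem _ _ (by simp [hπ])]
    simp only [schedSeqComp_exit 𝒳 𝒴 σ τ (List.get_mem 𝒳.Or k) hπ, hπ,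
      seqComp_prob_exit 𝒳 𝒴 h₁ h₂ hnd, ite_mul, one_mul, zero_mul, Finset.sum_ite_eq',
      Finset.mem_univ, if_true,
      reachN_seqComp_inr 𝒳 𝒴 h₁ h₂ σ τ hOl hY hne (FinPath.last_snoc _ _ _), Finset.sum_const,
      Finset.card_univ, nsmul_eq_mul]
    rw [← mul_assoc, mul_inv_cancel₀ hcard, one_mul]
    exact if_congr (by omega) rfl rfl

lemma reachN_seqComp_inl (hOl : 𝒴.Ol = []) (hX : 𝒳.M.OneStep) (hY : 𝒴.M.OneStep)
    (hnd : 𝒳.Or.Nodup) {t : S₂} (ht : t ∉ 𝒴.Ir) {s : S₁} (hs : s ∉ 𝒳.Or)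
    {π : FinPath (S₁ ⊕ S₂) (A₁ ⊕ A₂)} (hπ : π.last = Sum.inl s) (n : ℕ) :
    (𝒳.seqComp 𝒴 h₁ h₂).M.reachN (schedSeqComp 𝒳 𝒴 σ τ) {Sum.inr t} n π =
      if n < 3 then 0 else ∑ k, 𝒳.M.stepProb σ s (𝒳.Or.get k) *
        𝒴.M.stepProb τ (𝒴.Ir.get (Fin.cast h₁ k)) t := by
  cases n with
  | zero => simp [MDP.reachN, hπ]
  | succ n =>
    rw [MDP.reachN_succ_of_notMem _ _ (by simp [hπ])]
    simp only [Fintype.sum_sum_type, schedSeqComp_inl 𝒳 𝒴 σ τ hs hπ, hπ,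
      seqComp_prob_inl 𝒳 𝒴 h₁ h₂ hs,
      Sum.elim_inl, Sum.elim_inr, zero_mul, Finset.sum_const_zero, add_zero]
    have key : ∀ a : A₁, ∑ s', 𝒳.M.prob s a s' *
        (𝒳.seqComp 𝒴 h₁ h₂).M.reachN (schedSeqComp 𝒳 𝒴 σ τ) {Sum.inr t} n
          (π.snoc (Sum.inl a) (Sum.inl s')) =
        ∑ k, 𝒳.M.prob s a (𝒳.Or.get k) *
          if n < 2 then 0 else 𝒴.M.stepProb τ (𝒴.Ir.get (Fin.cast h₁ k)) t := by
      intro a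
      have : Nonempty (A₁ ⊕ A₂) := ⟨Sum.inl a⟩
      simp only [← reachN_seqComp_exit 𝒳 𝒴 h₁ h₂ σ τ hOl hY hnd ht _
        (FinPath.last_snoc π (Sum.inl a) _) n]
      symm
      refine Finset.sum_of_injOn (fun k => 𝒳.Or.get k)
        (List.nodup_iff_injective_get.1 hnd).injOn (by simp) ?_ (fun _ _ => rfl)
      intro s' _ hs'
      have hs'' : s' ∉ 𝒳.Or := fun hm => hs' (by
        obtain ⟨k, rfl⟩ := List.mem_iff_get.1 hm
        exact ⟨k, by simp, rfl⟩)
      by_cases hp : 𝒳.M.prob s a s' = 0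
      · simp [hp]
      · rw [MDP.reachN_eq_zero _ _ (by simp), mul_zero]
        rintro (a' | a') u
        · rw [FinPath.last_snoc, seqComp_prob_inl 𝒳 𝒴 h₁ h₂ hs'']
          cases u <;> simp [hX _ _ _ a' _ hp]
        · simp [schedSeqComp_inl 𝒳 𝒴 σ τ hs'' (FinPath.last_snoc _ _ _)]
    simp only [key]
    by_cases hn : n < 2
    · simp [hn, show n + 1 < 3 by omega]
    · simp only [hn, show ¬ n + 1 < 3 by omega, if_false, MDP.stepProb, Finset.mul_sum,
        Finset.sum_mul]
      rw [Finset.sum_comm]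
      refine Finset.sum_congr rfl fun k _ => ?_
      rw [Finset.sum_comm]
      simp only [mul_assoc]

/-- Reachability probabilities in the sequential composition of one-step open MDPs factor
through the connected open ends. -/
lemma Pr_seqComp (hOl : 𝒴.Ol = []) (hX : 𝒳.M.OneStep) (hY : 𝒴.M.OneStep)
    (hXp : 𝒳.M.Proper) (hYp : 𝒴.M.Proper) (hσ : 𝒳.M.IsSched σ) (hτ : 𝒴.M.IsSched τ)
    (hnd : 𝒳.Or.Nodup) {s : S₁} (hs : s ∉ 𝒳.Or) {t : S₂} (ht : t ∉ 𝒴.Ir) :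
    (𝒳.seqComp 𝒴 h₁ h₂).M.Pr (schedSeqComp 𝒳 𝒴 σ τ) (Sum.inl s) {Sum.inr t} =
      ∑ k, 𝒳.M.stepProb σ s (𝒳.Or.get k) *
        𝒴.M.stepProb τ (𝒴.Ir.get (Fin.cast h₁ k)) t :=
  MDP.Pr_eq_of_reachN _ _ _ _
    (Finset.sum_nonneg fun _ _ => mul_nonneg (MDP.stepProb_nonneg hXp hσ _ _)
      (MDP.stepProb_nonneg hYp hτ _ _)) 3
    fun n => reachN_seqComp_inl 𝒳 𝒴 h₁ h₂ σ τ hOl hX hY hnd ht hs (FinPath.last_nil _) n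

end SeqComp

section Shortcut

variable {S A : Type} [Fintype S] {𝒜 : OMDP S A}
  {B : 𝒜.EntrIdx → Finset (𝒜.ExitIdx → ℝ)}

lemma WF.notMem_exit (h : 𝒜.WF) {s : S} (hs : s ∈ 𝒜.entr) : s ∉ 𝒜.exit := by
  have := h.2.1
  rw [List.append_assoc, List.nodup_append] at this
  exact fun he => this.2.2 s hs s he rfl

lemma WF.nodup_exit (h : 𝒜.WF) : 𝒜.exit.Nodup := by
  have := h.2.1
  rw [List.append_assoc, List.nodup_append] at this
  exact this.2.1

lemma shortcut_proper (hB : ∀ k, ∀ p ∈ B k, Subdist p) : (𝒜.shortcut B).M.Proper := by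
  intro s a d hd
  obtain ⟨k, hk⟩ := a.2
  obtain ⟨h0, h1⟩ := hB k _ hk
  cases s with
  | none => simp [shortcut] at hd
  | some s =>
    simp only [shortcut] at hd
    split_ifs at hd with h
    obtain rfl := Option.some.inj hd
    constructor
    · rintro (_ | s')
      · exact sub_nonneg.2 h1
      · exact Finset.sum_nonneg fun j _ => by split_ifs <;> simp [h0]
    · rw [Fintype.sum_option, Finset.sum_comm]
      simp

omit [Fintype S] in
lemma shortcut_prob_ne_zero {s t : Option S} {a : ShortAct 𝒜 B}
    (h : (𝒜.shortcut B).M.prob s a t ≠ 0) :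
    (∃ x ∈ 𝒜.entr, s = some x) ∧ ∀ x, t = some x → x ∈ 𝒜.exit := by
  cases s with
  | none => simp [MDP.prob, shortcut] at h
  | some s =>
    simp only [MDP.prob, shortcut] at h
    split_ifs at h with hs
    · refine ⟨⟨s, hs.1, rfl⟩, ?_⟩
      rintro x rfl
      by_contra hx
      refine h (Finset.sum_eq_zero fun j _ => if_neg ?_)
      rintro rfl
      exact hx j.2
    · simp at h

lemma shortcut_oneStep (hW : 𝒜.WF) : (𝒜.shortcut B).M.OneStep := by
  intro s a s' a' s'' h
  by_contra h'
  obtain ⟨x, hx, rfl⟩ := (shortcut_prob_ne_zero h').1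
  exact hW.notMem_exit hx ((shortcut_prob_ne_zero h).2 x rfl)

end Shortcut

end OMDP

lemma abs_sum_mul_sub_sum_mul_le {ι : Type*} [Fintype ι] (x x' y y' : ι → ℝ) {ε δ : ℝ}
    (hδ : 0 ≤ δ) (hx' : ∀ k, 0 ≤ x' k) (hsum : ∑ k, x' k ≤ 1)
    (hy : ∀ k, |y k| ≤ 1) (hxx : ∀ k, |x k - x' k| ≤ ε) (hyy : ∀ k, |y k - y' k| ≤ δ) :
    |∑ k, x k * y k - ∑ k, x' k * y' k| ≤ Fintype.card ι * ε + δ := by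
  have h : ∑ k, x k * y k - ∑ k, x' k * y' k =
      ∑ k, (x k - x' k) * y k + ∑ k, x' k * (y k - y' k) := by
    rw [← Finset.sum_sub_distrib, ← Finset.sum_add_distrib]
    exact Finset.sum_congr rfl fun k _ => by ring
  rw [h]
  refine (abs_add_le _ _).trans (add_le_add ?_ ?_)
  · refine (Finset.abs_sum_le_sum_abs _ _).trans ?_
    refine (Finset.sum_le_sum (g := fun _ => ε) fun k _ => ?_).trans (by simp)
    rw [abs_mul]
    exact (mul_le_of_le_one_right (abs_nonneg _) (hy k)).trans (hxx k)
  · refine (Finset.abs_sum_le_sum_abs _ _).trans ?_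
    refine (Finset.sum_le_sum (g := fun k => x' k * δ) fun k _ => ?_).trans ?_
    · rw [abs_mul, abs_of_nonneg (hx' k)]
      exact mul_le_mul_of_nonneg_left (hyy k) (hx' k)
    · rw [← Finset.sum_mul]
      exact mul_le_of_le_one_left hδ hsum

end SD

open SD in
/-- Let `𝒜`, `ℬ` be rightward open MDPs with arities
`(m,0)→(l,0)`, `(l,0)→(n,0)`, `i` an entrance of `𝒜`, and `(L^𝒜,U^𝒜)`,
`(L^ℬ,U^ℬ)` sound approximations (given by vertex families of
subdistributions). Let `σ^𝒜`, `σ^ℬ` be memoryless schedulers on `D(U^𝒜)`,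
`D(U^ℬ)` and `τ^𝒜`, `τ^ℬ` memoryless schedulers on `D(L^𝒜)`, `D(L^ℬ)`. Set
`ε^𝒜 := sup_{k∈O^𝒜} |Pr^{D(U^𝒜),σ^𝒜}(i ⊨ ◇k) − Pr^{D(L^𝒜),τ^𝒜}(i ⊨ ◇k)|` and
`ε^ℬ := sup_{k∈I^ℬ} sup_{j∈O^ℬ} |Pr^{D(U^ℬ),σ^ℬ}(k ⊨ ◇j) − Pr^{D(L^ℬ),τ^ℬ}(k ⊨ ◇j)|`.
Then
`sup_{j∈O^ℬ} |Pr^{D(U^𝒜)⨟D(U^ℬ),σ^𝒜⨟σ^ℬ}(i ⊨ ◇j) − Pr^{D(L^𝒜)⨟D(L^ℬ),τ^𝒜⨟τ^ℬ}(i ⊨ ◇j)|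
≤ |O^𝒜| · ε^𝒜 + ε^ℬ`. -/
theorem statement_14 {S₁ A₁ S₂ A₂ : Type}
    [Fintype S₁] [Fintype A₁] [Fintype S₂] [Fintype A₂]
    (𝒜 : OMDP S₁ A₁) (ℬ : OMDP S₂ A₂) (hWFA : 𝒜.WF) (hWFB : ℬ.WF)
    (hAIl : 𝒜.Il = []) (hAOl : 𝒜.Ol = []) (hBIl : ℬ.Il = []) (hBOl : ℬ.Ol = [])
    (h₁ : 𝒜.Or.length = ℬ.Ir.length)
    (i : 𝒜.EntrIdx)
    (VLA VUA : 𝒜.EntrIdx → Finset (𝒜.ExitIdx → ℝ))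
    (VLB VUB : ℬ.EntrIdx → Finset (ℬ.ExitIdx → ℝ))
    (hVLA : ∀ k, ∀ p ∈ VLA k, Subdist p) (hVUA : ∀ k, ∀ p ∈ VUA k, Subdist p)
    (hVLB : ∀ k, ∀ p ∈ VLB k, Subdist p) (hVUB : ∀ k, ∀ p ∈ VUB k, Subdist p)
    (hsoundA : ∀ k : 𝒜.EntrIdx,
      dwConv ((VLA k : Finset (𝒜.ExitIdx → ℝ)) : Set (𝒜.ExitIdx → ℝ)) ⊆ 𝒜.achievable k.1 ∧
        𝒜.achievable k.1 ⊆ dwConv ((VUA k : Finset (𝒜.ExitIdx → ℝ)) : Set (𝒜.ExitIdx → ℝ)))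
    (hsoundB : ∀ k : ℬ.EntrIdx,
      dwConv ((VLB k : Finset (ℬ.ExitIdx → ℝ)) : Set (ℬ.ExitIdx → ℝ)) ⊆ ℬ.achievable k.1 ∧
        ℬ.achievable k.1 ⊆ dwConv ((VUB k : Finset (ℬ.ExitIdx → ℝ)) : Set (ℬ.ExitIdx → ℝ)))
    (gL₁ : (𝒜.shortcut VLA).Or.length = (ℬ.shortcut VLB).Ir.length)
    (gL₂ : (ℬ.shortcut VLB).Ol.length = (𝒜.shortcut VLA).Il.length)
    (gU₁ : (𝒜.shortcut VUA).Or.length = (ℬ.shortcut VUB).Ir.length)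
    (gU₂ : (ℬ.shortcut VUB).Ol.length = (𝒜.shortcut VUA).Il.length)
    (σA : Sched (Option S₁) (OMDP.ShortAct 𝒜 VUA))
    (σB : Sched (Option S₂) (OMDP.ShortAct ℬ VUB))
    (τA : Sched (Option S₁) (OMDP.ShortAct 𝒜 VLA))
    (τB : Sched (Option S₂) (OMDP.ShortAct ℬ VLB))
    (hσA : (𝒜.shortcut VUA).M.IsSched σA) (hσAm : Memoryless σA)
    (hσB : (ℬ.shortcut VUB).M.IsSched σB) (hσBm : Memoryless σB)
    (hτA : (𝒜.shortcut VLA).M.IsSched τA) (hτAm : Memoryless τA)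
    (hτB : (ℬ.shortcut VLB).M.IsSched τB) (hτBm : Memoryless τB) :
    (⨆ j : ℬ.ExitIdx,
        |((𝒜.shortcut VUA).seqComp (ℬ.shortcut VUB) gU₁ gU₂).M.Pr
              (OMDP.schedSeqComp (𝒜.shortcut VUA) (ℬ.shortcut VUB) σA σB)
              (Sum.inl (some i.1)) {Sum.inr (some j.1)} -
            ((𝒜.shortcut VLA).seqComp (ℬ.shortcut VLB) gL₁ gL₂).M.Pr
              (OMDP.schedSeqComp (𝒜.shortcut VLA) (ℬ.shortcut VLB) τA τB)
              (Sum.inl (some i.1)) {Sum.inr (some j.1)}|) ≤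
      (𝒜.exit.length : ℝ) *
          (⨆ k : 𝒜.ExitIdx,
            |(𝒜.shortcut VUA).M.Pr σA (some i.1) {some k.1} -
              (𝒜.shortcut VLA).M.Pr τA (some i.1) {some k.1}|) +
        ⨆ k : ℬ.EntrIdx, ⨆ j : ℬ.ExitIdx,
          |(ℬ.shortcut VUB).M.Pr σB (some k.1) {some j.1} -
            (ℬ.shortcut VLB).M.Pr τB (some k.1) {some j.1}| := by
  have hOrA : 𝒜.exit = 𝒜.Or := by simp [OMDP.exit, hAOl]
  have hIrB : ℬ.entr = ℬ.Ir := by simp [OMDP.entr, hBIl]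
  have hpUA := OMDP.shortcut_proper hVUA
  have hpLA := OMDP.shortcut_proper hVLA
  have hpUB := OMDP.shortcut_proper hVUB
  have hpLB := OMDP.shortcut_proper hVLB
  have hnd : (𝒜.Or.map some).Nodup :=
    (hOrA ▸ hWFA.nodup_exit).map (Option.some_injective _)
  have hi : some i.1 ∉ 𝒜.Or.map some := by
    simpa [hOrA] using hWFA.notMem_exit i.2
  have hδ : 0 ≤ ⨆ k : ℬ.EntrIdx, ⨆ j : ℬ.ExitIdx,
          |(ℬ.shortcut VUB).M.Pr σB (some k.1) {some j.1} -
            (ℬ.shortcut VLB).M.Pr τB (some k.1) {some j.1}| :=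
    Real.iSup_nonneg fun _ => Real.iSup_nonneg fun _ => abs_nonneg _
  refine Real.iSup_le (fun j => ?_) (add_nonneg (mul_nonneg (Nat.cast_nonneg _)
    (Real.iSup_nonneg fun _ => abs_nonneg _)) hδ)
  have hj : some j.1 ∉ ℬ.Ir.map some := by
    simpa [hIrB] using fun h => hWFB.notMem_exit h j.2
  have hOlU : (ℬ.shortcut VUB).Ol = [] := by simp [OMDP.shortcut, hBOl]
  have hOlL : (ℬ.shortcut VLB).Ol = [] := by simp [OMDP.shortcut, hBOl]
  rw [OMDP.Pr_seqComp _ _ gU₁ gU₂ σA σB hOlU (OMDP.shortcut_oneStep hWFA)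
      (OMDP.shortcut_oneStep hWFB) hpUA hpUB hσA hσB hnd hi hj,
    OMDP.Pr_seqComp _ _ gL₁ gL₂ τA τB hOlL (OMDP.shortcut_oneStep hWFA)
      (OMDP.shortcut_oneStep hWFB) hpLA hpLB hτA hτB hnd hi hj]
  have hcard : (𝒜.exit.length : ℝ) = Fintype.card (Fin (𝒜.Or.map some).length) := by
    simp [hOrA]
  rw [hcard]
  refine abs_sum_mul_sub_sum_mul_le (ι := Fin (𝒜.Or.map some).length) _ _ _ _ hδ
    (fun _ => MDP.stepProb_nonneg hpLA hτA _ _) ?_ (fun _ => ?_) (fun k => ?_) (fun k => ?_)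
  · refine le_trans ?_ (MDP.sum_stepProb_le_one hpLA hτA (some i.1))
    refine le_trans (le_of_eq (Finset.sum_map Finset.univ
      ⟨(𝒜.Or.map some).get, List.nodup_iff_injective_get.1 hnd⟩
      ((𝒜.shortcut VLA).M.stepProb τA (some i.1))).symm) ?_
    exact Finset.sum_le_sum_of_subset_of_nonneg (Finset.subset_univ _)
      fun _ _ _ => MDP.stepProb_nonneg hpLA hτA _ _
  · rw [abs_of_nonneg (MDP.stepProb_nonneg hpUB hσB _ _)]
    exact MDP.stepProb_le_one hpUB hσB _ _
  · obtain ⟨o, ho, hok⟩ := List.mem_map.1 (List.get_mem (𝒜.Or.map some) k)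
    have hne : some i.1 ≠ some o := fun h => hi (h ▸ List.mem_map_of_mem ho)
    change |(𝒜.shortcut VUA).M.stepProb σA (some i.1) ((𝒜.Or.map some).get k) -
      (𝒜.shortcut VLA).M.stepProb τA (some i.1) ((𝒜.Or.map some).get k)| ≤ _
    rw [← hok, ← (OMDP.shortcut_oneStep hWFA).Pr_eq_stepProb hpUA hσA hne,
      ← (OMDP.shortcut_oneStep hWFA).Pr_eq_stepProb hpLA hτA hne]
    exact le_ciSup (f := fun k : 𝒜.ExitIdx =>
      |(𝒜.shortcut VUA).M.Pr σA (some i.1) {some k.1} -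
        (𝒜.shortcut VLA).M.Pr τA (some i.1) {some k.1}|)
      (Set.finite_range _).bddAbove ⟨o, hOrA ▸ ho⟩
  · set k' : Fin (ℬ.Ir.map some).length := Fin.cast gU₁ k
    obtain ⟨o, ho, hok⟩ := List.mem_map.1 (List.get_mem (ℬ.Ir.map some) k')
    have hne : some o ≠ some j.1 := fun h => hj (h ▸ List.mem_map_of_mem ho)
    change |(ℬ.shortcut VUB).M.stepProb σB ((ℬ.Ir.map some).get k') (some j.1) -
      (ℬ.shortcut VLB).M.stepProb τB ((ℬ.Ir.map some).get k') (some j.1)| ≤ _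
    rw [← hok, ← (OMDP.shortcut_oneStep hWFB).Pr_eq_stepProb hpUB hσB hne,
      ← (OMDP.shortcut_oneStep hWFB).Pr_eq_stepProb hpLB hτB hne]
    refine (le_ciSup (f := fun j : ℬ.ExitIdx =>
      |(ℬ.shortcut VUB).M.Pr σB (some o) {some j.1} -
        (ℬ.shortcut VLB).M.Pr τB (some o) {some j.1}|)
      (Set.finite_range _).bddAbove j).trans ?_
    exact le_ciSup (f := fun k : ℬ.EntrIdx => ⨆ j : ℬ.ExitIdx,
      |(ℬ.shortcut VUB).M.Pr σB (some k.1) {some j.1} -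
        (ℬ.shortcut VLB).M.Pr τB (some k.1) {some j.1}|)
      (Set.finite_range _).bddAbove ⟨o, hIrB ▸ ho⟩
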